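/- Let E be a centrally orthocomplete pseudo-effect algebra, (pᵢ)_{i∈I} a Γ-orthogonal family in E, p := ⋁_{i∈I} pᵢ, and X := ∏_{i∈I} E[0,pᵢ]. Define Φ : X → E[0,p] by Φ((eᵢ)_{i∈I}) := ⋁_{i∈I} eᵢ. Then Φ is a PEA-isomorphism of X onto E[0,p], and Φ⁻¹(e) = (e ∧ γpᵢ)_{i∈I} for every e ∈ E[0,p]. -/

import Mathlib

namespace PEApaper

/-- The bare data of a partial-addition structure: a partial binary operation
(encoded via `Option`) together with constants `0` and `1`. -/
structure PartialStruct (E : Type) where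
  padd : E → E → Option E
  zero : E
  one : E

namespace PartialStruct

variable {E : Type}

/-- `a ≤ b` iff `a + c = b` for some `c`. -/
def le (P : PartialStruct E) (a b : E) : Prop := ∃ c, P.padd a c = some b

/-- `m` is the greatest lower bound (meet `a ∧ b`) of `a` and `b`. -/
def IsMeet (P : PartialStruct E) (a b m : E) : Prop :=
  P.le m a ∧ P.le m b ∧ ∀ x, P.le x a → P.le x b → P.le x m

/-- `j` is the least upper bound (join `a ∨ b`) of `a` and `b`. -/
def IsJoin (P : PartialStruct E) (a b j : E) : Prop :=
  P.le a j ∧ P.le b j ∧ ∀ x, P.le a x → P.le b x → P.le j x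

/-- `s` is the supremum of the set `S`. -/
def IsSup (P : PartialStruct E) (S : Set E) (s : E) : Prop :=
  (∀ x ∈ S, P.le x s) ∧ ∀ u, (∀ x ∈ S, P.le x u) → P.le s u

/-- Left-associated partial sum of a list, continuing from `acc`. -/
def IsSumFrom (P : PartialStruct E) : E → List E → E → Prop
  | acc, [], s => s = acc
  | acc, a :: l, s => ∃ t, P.padd acc a = some t ∧ IsSumFrom P t l s

/-- `s` is the (left-associated) orthosum `e₁ + e₂ + ⋯ + eₙ` of the list. -/
def IsSumList (P : PartialStruct E) (l : List E) (s : E) : Prop :=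
  match l with
  | [] => s = P.zero
  | a :: t => IsSumFrom P a t s

/-- `c` is a central element: there is a PEA-isomorphism
`f : E → E[0,c] × E[0,c∼]` with `f c = (c,0)` such that `f x = (x₁,x₂)`
implies `x = x₁ + x₂`.  The isomorphism onto the product of the two
interval pseudo-effect algebras is spelled out explicitly. -/
def IsCentral (P : PartialStruct E) (c : E) : Prop :=
  ∃ cs, P.padd c cs = some P.one ∧
    ∃ f : E → E × E,
      (∀ x, P.le (f x).1 c ∧ P.le (f x).2 cs) ∧
      Function.Injective f ∧
      (∀ y : E × E, P.le y.1 c → P.le y.2 cs → ∃ x, f x = y) ∧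
      f c = (c, P.zero) ∧
      f P.one = (c, cs) ∧
      (∀ x, P.padd (f x).1 (f x).2 = some x) ∧
      (∀ a b ab, P.padd a b = some ab →
        P.padd (f a).1 (f b).1 = some (f ab).1 ∧
        P.padd (f a).2 (f b).2 = some (f ab).2) ∧
      (∀ a b s t, P.padd (f a).1 (f b).1 = some s → P.le s c →
        P.padd (f a).2 (f b).2 = some t → P.le t cs →
        ∃ ab, P.padd a b = some ab)

/-- The center `Γ(E)`. -/
def center (P : PartialStruct E) : Set E := {c | P.IsCentral c}

/-- The central interval `Γ(E)[0,c] = Γ(E) ∩ E[0,c]`. -/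
def centerIntervalSet (P : PartialStruct E) (c : E) : Set E :=
  {x | P.IsCentral x ∧ P.le x c}

/-- A Γ-orthogonal family: one dominated elementwise by a pairwise
disjoint family of central elements. -/
def GammaOrthogonal (P : PartialStruct E) {I : Type} (e : I → E) : Prop :=
  ∃ c : I → E, (∀ i, P.IsCentral (c i)) ∧
    (∀ i j, i ≠ j → P.IsMeet (c i) (c j) P.zero) ∧
    ∀ i, P.le (e i) (c i)

/-- Centrally orthocomplete: every Γ-orthogonal family has a supremum. -/
def IsCOPEA (P : PartialStruct E) : Prop :=
  ∀ (I : Type) (e : I → E), P.GammaOrthogonal e → ∃ s, P.IsSup (Set.range e) s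

/-- `c` is the central cover of `e`: the smallest central element above `e`. -/
def IsCentralCover (P : PartialStruct E) (c e : E) : Prop :=
  P.IsCentral c ∧ P.le e c ∧ ∀ d, P.IsCentral d → P.le e d → P.le c d

/-- `[Q]`: the set of all suprema of Γ-orthogonal families of elements of `Q`. -/
def bra (P : PartialStruct E) (Q : Set E) : Set E :=
  {s | ∃ (I : Type) (e : I → E), (∀ i, e i ∈ Q) ∧ P.GammaOrthogonal e ∧
    P.IsSup (Set.range e) s}

/-- `Q^γ = {q ∧ c : q ∈ Q, c ∈ Γ(E)}`. -/
def gammaClosure (P : PartialStruct E) (Q : Set E) : Set E :=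
  {m | ∃ q ∈ Q, ∃ c, P.IsCentral c ∧ P.IsMeet q c m}

/-- `Q↓ = ⋃_{q ∈ Q} E[0,q]`. -/
def downSet (P : PartialStruct E) (Q : Set E) : Set E :=
  {e | ∃ q ∈ Q, P.le e q}

/-- `Q' = {e ∈ E : q ∧ e = 0 for all q ∈ Q}`. -/
def commutant (P : PartialStruct E) (Q : Set E) : Set E :=
  {e | ∀ q ∈ Q, P.IsMeet q e P.zero}

/-- A type-determining (TD) set: `K = [K] = K^γ`. -/
def IsTD (P : PartialStruct E) (K : Set E) : Prop :=
  P.bra K = K ∧ P.gammaClosure K = K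

/-- A strongly type-determining (STD) set: `K = [K] = K↓`. -/
def IsSTD (P : PartialStruct E) (K : Set E) : Prop :=
  P.bra K = K ∧ P.downSet K = K

/-- `c` is the type-cover of `K` (w.r.t. the central cover map `γ`):
the unique central element with `γK = Γ(E)[0,c]`. -/
def IsTypeCover (P : PartialStruct E) (γ : E → E) (K : Set E) (c : E) : Prop :=
  P.IsCentral c ∧ γ '' K = P.centerIntervalSet c

/-- An atom: a nonzero element with no proper nonzero subelement. -/
def IsAtom' (P : PartialStruct E) (a : E) : Prop :=
  a ≠ P.zero ∧ ∀ x, P.le x a → x = P.zero ∨ x = a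

end PartialStruct

/-- A PEA-isomorphism between two partial-addition structures: a bijective
morphism whose inverse is a morphism. -/
structure IsPEAIso {A B : Type} (P : PartialStruct A) (Q : PartialStruct B)
    (f : A → B) : Prop where
  bijective : Function.Bijective f
  map_one : f P.one = Q.one
  map_add : ∀ a b ab, P.padd a b = some ab → Q.padd (f a) (f b) = some (f ab)
  rev_add : ∀ a b s, Q.padd (f a) (f b) = some s → ∃ ab, P.padd a b = some ab

open scoped Classical in
/-- The (coordinatewise) product of a family of partial structures. -/
noncomputable def prodStruct {I : Type} {A : I → Type}
    (Ps : ∀ i, PartialStruct (A i)) : PartialStruct (∀ i, A i) where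
  padd a b :=
    if h : ∀ i, ∃ s, (Ps i).padd (a i) (b i) = some s
    then some fun i => Classical.choose (h i)
    else none
  zero := fun i => (Ps i).zero
  one := fun i => (Ps i).one

/-- A pseudo-effect algebra. -/
structure PEA (E : Type) extends PartialStruct E where
  assoc_def : ∀ a b c : E,
    (∃ ab, padd a b = some ab ∧ ∃ x, padd ab c = some x) ↔
    (∃ bc, padd b c = some bc ∧ ∃ y, padd a bc = some y)
  assoc_eq : ∀ a b c ab bc x y, padd a b = some ab → padd ab c = some x →
    padd b c = some bc → padd a bc = some y → x = y
  exu_right : ∀ a : E, ∃! d, padd a d = some one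
  exu_left : ∀ a : E, ∃! e, padd e a = some one
  shift : ∀ a b ab, padd a b = some ab →
    (∃ d, padd d a = some ab) ∧ (∃ e, padd b e = some ab)
  one_add : ∀ a x, padd one a = some x → a = zero
  add_one : ∀ a x, padd a one = some x → a = zero

namespace PEA

variable {E : Type} (P : PEA E)

/-- Shorthand for the underlying partial structure. -/
abbrev ps : PartialStruct E := P.toPartialStruct

theorem one_add_zero : P.padd P.one P.zero = some P.one := by
  obtain ⟨d, hd, -⟩ := P.exu_right P.one
  have h := P.one_add d P.one hd
  rwa [h] at hd

theorem zero_add_one : P.padd P.zero P.one = some P.one := by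
  obtain ⟨e, he, -⟩ := P.exu_left P.one
  have h := P.add_one e P.one he
  rwa [h] at he

theorem padd_zero (a : E) : P.padd a P.zero = some a := by
  obtain ⟨e, he, -⟩ := P.exu_left a
  have h1 : ∃ ab, P.padd e a = some ab ∧ ∃ x, P.padd ab P.zero = some x :=
    ⟨P.one, he, P.one, P.one_add_zero⟩
  obtain ⟨t, ht, y, hy⟩ := (P.assoc_def e a P.zero).mp h1
  have hxy : P.one = y :=
    P.assoc_eq e a P.zero P.one t P.one y he P.one_add_zero ht hy
  obtain ⟨d, hd, hu⟩ := P.exu_right e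
  have hta : t = a := by
    have h2 : t = d := hu t (by rw [← hxy] at hy; exact hy)
    have h3 : a = d := hu a he
    rw [h2, h3]
  rwa [hta] at ht

theorem zero_padd (a : E) : P.padd P.zero a = some a := by
  obtain ⟨d, hd, -⟩ := P.exu_right a
  have h1 : ∃ bc, P.padd a d = some bc ∧ ∃ y, P.padd P.zero bc = some y :=
    ⟨P.one, hd, P.one, P.zero_add_one⟩
  obtain ⟨t, ht, y, hy⟩ := (P.assoc_def P.zero a d).mpr h1
  have hxy : y = P.one :=
    P.assoc_eq P.zero a d t P.one y P.one ht hy hd P.zero_add_one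
  obtain ⟨e, he, hu⟩ := P.exu_left d
  have hta : t = a := by
    have h2 : t = e := hu t (by rw [hxy] at hy; exact hy)
    have h3 : a = e := hu a hd
    rw [h2, h3]
  rwa [hta] at ht

theorem zero_le (a : E) : P.ps.le P.zero a := ⟨a, P.zero_padd a⟩

theorem le_refl (a : E) : P.ps.le a a := ⟨P.zero, P.padd_zero a⟩

open scoped Classical in
/-- The interval pseudo-effect algebra `E[0,p]` as a partial structure on
the subtype `{x // x ≤ p}`; the sum is defined iff it is defined in `E`
and lies below `p`, and the unit is `p`. -/
noncomputable def intervalStruct (p : E) :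
    PartialStruct {x : E // P.ps.le x p} where
  padd a b := (P.padd a.1 b.1).bind fun s =>
    if h : P.ps.le s p then some ⟨s, h⟩ else none
  zero := ⟨P.zero, P.zero_le p⟩
  one := ⟨p, P.le_refl p⟩

end PEA

/-- The order relation of a complete Boolean algebra structure, made explicit. -/
def cbaLe {X : Type} (inst : CompleteBooleanAlgebra X) (a b : X) : Prop :=
  @LE.le X (by letI := inst; exact inferInstance) a b

end PEApaper

namespace PEApaper

theorem prodStruct_padd_eq_some {I : Type} {A : I → Type} (Ps : ∀ i, PartialStruct (A i))
    (a b s : ∀ i, A i) :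
    (prodStruct Ps).padd a b = some s ↔ ∀ i, (Ps i).padd (a i) (b i) = some (s i) := by
  classical
  simp only [prodStruct]
  split_ifs with h
  · constructor
    · intro hs i
      rw [← Option.some.inj hs]
      exact Classical.choose_spec (h i)
    · intro hs
      congr 1
      funext i
      exact Option.some.inj ((Classical.choose_spec (h i)).symm.trans (hs i))
  · simp only [false_iff]
    exact fun hs => h fun i => ⟨_, hs i⟩

namespace PEA

variable {E : Type} (P : PEA E)

theorem intervalStruct_padd_eq_some {p : E} (a b s : {x : E // P.ps.le x p}) :
    (P.intervalStruct p).padd a b = some s ↔ P.padd a.1 b.1 = some s.1 := by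
  classical
  simp only [intervalStruct, Option.bind_eq_some_iff]
  constructor
  · rintro ⟨t, ht, hs⟩
    split_ifs at hs with h
    rw [← Option.some.inj hs]
    exact ht
  · intro h
    exact ⟨s.1, h, by rw [dif_pos s.2]⟩

variable {P}

theorem exists_padd_of_left {a b c ab x : E} (h : P.padd a b = some ab)
    (h' : P.padd ab c = some x) : ∃ bc, P.padd b c = some bc ∧ P.padd a bc = some x := by
  obtain ⟨bc, hbc, y, hy⟩ := (P.assoc_def a b c).mp ⟨ab, h, x, h'⟩
  exact ⟨bc, hbc, (P.assoc_eq a b c ab bc x y h h' hbc hy) ▸ hy⟩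

theorem exists_padd_of_right {a b c bc x : E} (h : P.padd b c = some bc)
    (h' : P.padd a bc = some x) : ∃ ab, P.padd a b = some ab ∧ P.padd ab c = some x := by
  obtain ⟨ab, hab, y, hy⟩ := (P.assoc_def a b c).mpr ⟨bc, h, x, h'⟩
  exact ⟨ab, hab, (P.assoc_eq a b c ab bc y x hab hy h h') ▸ hy⟩

theorem padd_left_cancel {a b c s : E} (hb : P.padd a b = some s) (hc : P.padd a c = some s) :
    b = c := by
  obtain ⟨e, he, -⟩ := P.exu_left s
  obtain ⟨t, ht, hb'⟩ := exists_padd_of_right hb he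
  obtain ⟨t', ht', hc'⟩ := exists_padd_of_right hc he
  obtain rfl : t = t' := Option.some.inj (ht.symm.trans ht')
  exact (P.exu_right t).unique hb' hc'

theorem padd_right_cancel {a b c s : E} (hb : P.padd b a = some s) (hc : P.padd c a = some s) :
    b = c := by
  obtain ⟨e, he, -⟩ := P.exu_right s
  obtain ⟨t, ht, hb'⟩ := exists_padd_of_left hb he
  obtain ⟨t', ht', hc'⟩ := exists_padd_of_left hc he
  obtain rfl : t = t' := Option.some.inj (ht.symm.trans ht')
  exact (P.exu_left t).unique hb' hc'

theorem le_trans {a b c : E} (hab : P.ps.le a b) (hbc : P.ps.le b c) : P.ps.le a c := by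
  obtain ⟨x, hx⟩ := hab
  obtain ⟨y, hy⟩ := hbc
  obtain ⟨t, -, ht⟩ := exists_padd_of_left hx hy
  exact ⟨t, ht⟩

theorem eq_zero_of_padd_eq_zero {a b : E} (h : P.padd a b = some P.zero) : a = P.zero := by
  obtain ⟨t, ht, -⟩ := exists_padd_of_right h P.one_add_zero
  exact P.one_add a t ht

theorem le_antisymm {a b : E} (hab : P.ps.le a b) (hba : P.ps.le b a) : a = b := by
  obtain ⟨x, hx⟩ := hab
  obtain ⟨y, hy⟩ := hba
  obtain ⟨t, ht, h⟩ := exists_padd_of_left hx hy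
  obtain rfl : t = P.zero := padd_left_cancel h (P.padd_zero a)
  rw [eq_zero_of_padd_eq_zero ht] at hx
  exact Option.some.inj ((P.padd_zero a).symm.trans hx)

theorem eq_zero_of_le_zero {a : E} (h : P.ps.le a P.zero) : a = P.zero :=
  le_antisymm h (P.zero_le a)

theorem le_of_padd_left {a b s : E} (h : P.padd a b = some s) : P.ps.le a s := ⟨b, h⟩

theorem le_of_padd_right {a b s : E} (h : P.padd a b = some s) : P.ps.le b s :=
  (P.shift a b s h).2

theorem exists_padd_eq_of_le {a b : E} (h : P.ps.le a b) : ∃ d, P.padd d a = some b := by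
  obtain ⟨c, hc⟩ := h
  exact (P.shift a c b hc).1

theorem isSup_unique {S : Set E} {s t : E} (hs : P.ps.IsSup S s) (ht : P.ps.IsSup S t) :
    s = t :=
  le_antisymm (hs.2 t ht.1) (ht.2 s hs.1)

/-- The map `x ↦ x ∧ c` for central `c`, together with the complementary projection. -/
structure IsProj (P : PEA E) (c : E) (π π' : E → E) : Prop where
  isMeet : ∀ x, P.ps.IsMeet x c (π x)
  padd_compl : ∀ x, P.padd (π x) (π' x) = some x
  map_padd : ∀ {a b s}, P.padd a b = some s → P.padd (π a) (π b) = some (π s)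
  map_padd_compl : ∀ {a b s}, P.padd a b = some s → P.padd (π' a) (π' b) = some (π' s)
  exists_replace : ∀ {a}, P.ps.le a c → ∀ x, ∃ u, P.padd a (π' x) = some u ∧ π u = a

theorem exists_isProj {c : E} (hc : P.ps.IsCentral c) : ∃ π π', P.IsProj c π π' := by
  obtain ⟨cs, -, f, hle, -, hsurj, -, -, hsum, hadd, -⟩ := hc
  have hfix : ∀ y, P.ps.le y c → f y = (y, P.zero) := by
    intro y hy
    obtain ⟨z, hz⟩ := hsurj (y, P.zero) hy (P.zero_le cs)
    have h := hsum z
    rw [hz] at h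
    obtain rfl : y = z := Option.some.inj ((P.padd_zero y).symm.trans h)
    exact hz
  refine ⟨fun x => (f x).1, fun x => (f x).2, ⟨fun x => ⟨le_of_padd_left (hsum x), (hle x).1,
    ?_⟩, hsum, fun h => (hadd _ _ _ h).1, fun h => (hadd _ _ _ h).2, ?_⟩⟩
  · rintro y ⟨w, hw⟩ hyc
    have h := (hadd _ _ _ hw).1
    rw [hfix y hyc] at h
    exact le_of_padd_left h
  · intro a ha x
    obtain ⟨u, hu⟩ := hsurj (a, (f x).2) ha (hle x).2
    have h := hsum u
    rw [hu] at h
    exact ⟨u, h, by rw [hu]⟩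

namespace IsProj

variable {c : E} {π π' : E → E}

theorem mono (h : P.IsProj c π π') {x y : E} (hxy : P.ps.le x y) : P.ps.le (π x) (π y) := by
  obtain ⟨d, hd⟩ := hxy
  exact le_of_padd_left (h.map_padd hd)

theorem mono_compl (h : P.IsProj c π π') {x y : E} (hxy : P.ps.le x y) : P.ps.le (π' x) (π' y) := by
  obtain ⟨d, hd⟩ := hxy
  exact le_of_padd_left (h.map_padd_compl hd)

theorem eq_self (h : P.IsProj c π π') {x : E} (hx : P.ps.le x c) : π x = x :=
  le_antisymm (h.isMeet x).1 ((h.isMeet x).2.2 x (P.le_refl x) hx)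

theorem eq_zero_of_disjoint (h : P.IsProj c π π') {d x : E} (hcd : P.ps.IsMeet c d P.zero) (hx : P.ps.le x d) :
    π x = P.zero :=
  eq_zero_of_le_zero (hcd.2.2 _ (h.isMeet x).2.1 (le_trans (h.isMeet x).1 hx))

theorem compl_eq_self (h : P.IsProj c π π') {x : E} (hx : π x = P.zero) : π' x = x := by
  have hs := h.padd_compl x
  rw [hx] at hs
  exact Option.some.inj ((P.zero_padd _).symm.trans hs)

end IsProj

section Family

variable {I : Type} {c : I → E} {π π' : I → E → E}

/-- The `i`-th projection recovers the `i`-th member of a family from its supremum. -/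
theorem proj_sup (hπ : ∀ i, P.IsProj (c i) (π i) (π' i))
    (hc : ∀ i j, i ≠ j → P.ps.IsMeet (c i) (c j) P.zero) {e : I → E}
    (he : ∀ i, P.ps.le (e i) (c i)) {s : E} (hs : P.ps.IsSup (Set.range e) s) (i : I) :
    π i s = e i := by
  obtain ⟨u, hu, hui⟩ := (hπ i).exists_replace (he i) s
  have hsu : P.ps.le s u := by
    refine hs.2 u ?_
    rintro _ ⟨j, rfl⟩
    by_cases hij : i = j
    · subst hij
      exact le_of_padd_left hu
    · have h0 := (hπ i).eq_zero_of_disjoint (hc i j hij) (he j)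
      have h1 := (hπ i).mono_compl (hs.1 _ ⟨j, rfl⟩)
      rw [(hπ i).compl_eq_self h0] at h1
      exact le_trans h1 (le_of_padd_right hu)
  apply le_antisymm
  · have h1 := (hπ i).mono hsu
    rwa [hui] at h1
  · have h1 := (hπ i).mono (hs.1 _ ⟨i, rfl⟩)
    rwa [(hπ i).eq_self (he i)] at h1

/-- Below the supremum of a `Γ`-orthogonal family, an element is determined by its
projections. -/
theorem eq_of_isSup_proj (hπ : ∀ i, P.IsProj (c i) (π i) (π' i))
    (hc : ∀ i j, i ≠ j → P.ps.IsMeet (c i) (c j) P.zero) {p : I → E}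
    (hp : ∀ i, P.ps.le (p i) (c i)) {q : E} (hq : P.ps.IsSup (Set.range p) q) {x s : E}
    (hx : P.ps.le x q) (hs : P.ps.IsSup (Set.range fun i => π i x) s) : s = x := by
  obtain ⟨r, hr⟩ : P.ps.le s x := by
    refine hs.2 x ?_
    rintro _ ⟨i, rfl⟩
    exact ((hπ i).isMeet x).1
  have hr0 : ∀ i, π i r = P.zero := by
    intro i
    have h := (hπ i).map_padd hr
    rw [proj_sup hπ hc (fun j => ((hπ j).isMeet x).2.1) hs i] at h
    exact padd_left_cancel h (P.padd_zero _)
  obtain ⟨y, hy⟩ := exists_padd_eq_of_le (le_trans (le_of_padd_right hr) hx)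
  have hqy : P.ps.le q y := by
    refine hq.2 y ?_
    rintro _ ⟨i, rfl⟩
    have h := (hπ i).map_padd hy
    rw [hr0, proj_sup hπ hc hp hq] at h
    rw [← Option.some.inj ((P.padd_zero _).symm.trans h)]
    exact ((hπ i).isMeet y).1
  obtain rfl : q = y := le_antisymm hqy (le_of_padd_left hy)
  obtain rfl : r = P.zero := padd_left_cancel hy (P.padd_zero _)
  exact Option.some.inj ((P.padd_zero _).symm.trans hr)

end Family

end PEA

end PEApaper

open PEApaper PEApaper.PartialStruct in
/-- Theorem 4.12: in a COPEA, for a Γ-orthogonal family `(pᵢ)` with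
`p := ⋁ᵢ pᵢ`, the map `Φ((eᵢ)ᵢ) := ⋁ᵢ eᵢ` is a PEA-isomorphism of
`∏ᵢ E[0,pᵢ]` onto `E[0,p]`, with `Φ⁻¹(e) = (e ∧ γpᵢ)ᵢ`. -/
theorem stmt11 {E I : Type} (P : PEA E) (hco : P.ps.IsCOPEA)
    (γ : E → E) (hγ : ∀ e, P.ps.IsCentralCover (γ e) e)
    (p : I → E) (hp : P.ps.GammaOrthogonal p)
    (psup : E) (hpsup : P.ps.IsSup (Set.range p) psup)
    (Φ : (∀ i, {x : E // P.ps.le x (p i)}) → {x : E // P.ps.le x psup})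
    (hΦ : ∀ e, P.ps.IsSup (Set.range fun i => (e i).1) (Φ e).1) :
    IsPEAIso (prodStruct fun i => P.intervalStruct (p i))
      (P.intervalStruct psup) Φ ∧
    ∀ (x : {y : E // P.ps.le y psup}) (e : ∀ i, {y : E // P.ps.le y (p i)}),
      Φ e = x → ∀ i, P.ps.IsMeet x.1 (γ (p i)) (e i).1 := by
  obtain ⟨c, hcen, hc, hpc⟩ := hp
  choose π π' hπ using fun i => PEA.exists_isProj (hcen i)
  have hΦπ : ∀ e i, π i (Φ e).1 = (e i).1 := fun e i =>
    PEA.proj_sup hπ hc (fun j => PEA.le_trans (e j).2 (hpc j)) (hΦ e) i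
  have hle : ∀ x, P.ps.le x psup → ∀ i, P.ps.le (π i x) (p i) := by
    intro x hx i
    have h := (hπ i).mono hx
    rwa [PEA.proj_sup hπ hc hpc hpsup i] at h
  have hΦeq : ∀ x, P.ps.le x psup → ∀ e, (∀ i, π i x = (e i).1) → (Φ e).1 = x := by
    intro x hx e he
    refine PEA.eq_of_isSup_proj hπ hc hpc hpsup hx ?_
    simp only [he]
    exact hΦ e
  refine ⟨⟨⟨?_, ?_⟩, ?_, ?_, ?_⟩, ?_⟩
  · intro e e' h
    funext i
    apply Subtype.ext
    rw [← hΦπ e i, ← hΦπ e' i, h]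
  · intro x
    exact ⟨fun i => ⟨π i x.1, hle x.1 x.2 i⟩, Subtype.ext (hΦeq x.1 x.2 _ fun _ => rfl)⟩
  · exact Subtype.ext (PEA.isSup_unique (hΦ _) hpsup)
  · intro a b s hs
    simp only [prodStruct_padd_eq_some, PEA.intervalStruct_padd_eq_some] at hs ⊢
    obtain ⟨d, hd⟩ : P.ps.le (Φ a).1 (Φ s).1 := by
      refine (hΦ a).2 _ ?_
      rintro _ ⟨i, rfl⟩
      exact PEA.le_trans (PEA.le_of_padd_left (hs i)) ((hΦ s).1 _ ⟨i, rfl⟩)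
    rw [hΦeq d (PEA.le_trans (PEA.le_of_padd_right hd) (Φ s).2) b ?_]
    · exact hd
    · intro i
      have h := (hπ i).map_padd hd
      rw [hΦπ, hΦπ] at h
      exact PEA.padd_left_cancel h (hs i)
  · intro a b s hs
    rw [PEA.intervalStruct_padd_eq_some] at hs
    refine ⟨fun i => ⟨π i s.1, hle s.1 s.2 i⟩, ?_⟩
    simp only [prodStruct_padd_eq_some, PEA.intervalStruct_padd_eq_some]
    intro i
    have h := (hπ i).map_padd hs
    rwa [hΦπ, hΦπ] at h
  · rintro _ e rfl i
    refine ⟨(hΦ e).1 _ ⟨i, rfl⟩, PEA.le_trans (e i).2 (hγ (p i)).2.1, fun y hy hyγ => ?_⟩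
    rw [← hΦπ e i]
    exact ((hπ i).isMeet _).2.2 y hy
      (PEA.le_trans hyγ ((hγ (p i)).2.2 (c i) (hcen i) (hpc i)))
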